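/- Corollary of Theorems 1 and 2: Let M = ((U,V,R),F) and M' = ((U',V',R'),F') be strongly recursive causal models with U ⊆ U', V ⊆ V', and W⃗ = U' − U. If M is functionally equivalent to M' (with some witness w⃗ ∈ R(W⃗)), then for all variables X, Y ∈ V: if X is an ancestor of Y in M, then X is an ancestor of Y in M'. -/

import Mathlib

set_option linter.unusedVariables false

attribute [local instance] Classical.propDecidable

/-- A causal model `M = ((U,V,R),F)` with exogenous variables `U`, endogenous
variables `V`, ranges `RU u` / `RV v`, and for each endogenous variable a
structural equation giving its value in terms of the values of all the other
variables (the equation may not depend on the variable's own value). -/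
structure CausalModel (U V : Type) (RU : U → Type) (RV : V → Type) where
  F : ∀ X : V, (∀ u, RU u) → (∀ v, RV v) → RV X
  selfIndep : ∀ (X : V) (ctx : ∀ u, RU u) (a a' : ∀ v, RV v),
    (∀ Y : V, Y ≠ X → a Y = a' Y) → F X ctx a = F X ctx a'

namespace CausalModel

variable {U V : Type} {RU : U → Type} {RV : V → Type}

/-- `Y` depends on the endogenous variable `X`: for some context and some setting
of the endogenous variables, varying the value of `X` changes the value of `F Y`.
(`X` is then an (endogenous) parent of `Y`.) -/
def DependsOnE (M : CausalModel U V RU RV) (Y X : V) : Prop :=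
  X ≠ Y ∧ ∃ (ctx : ∀ u, RU u) (a : ∀ v, RV v) (x x' : RV X),
    M.F Y ctx (Function.update a X x) ≠ M.F Y ctx (Function.update a X x')

/-- `Y` depends on the exogenous variable `X`. -/
def DependsOnX (M : CausalModel U V RU RV) (Y : V) (X : U) : Prop :=
  ∃ (ctx : ∀ u, RU u) (a : ∀ v, RV v) (x x' : RU X),
    M.F Y (Function.update ctx X x) a ≠ M.F Y (Function.update ctx X x') a

/-- `M` is strongly recursive: there is a (strict) partial order on the
endogenous variables such that whenever `Y` depends on `X`, `X` strictly
precedes `Y`. -/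
def StronglyRecursive (M : CausalModel U V RU RV) : Prop :=
  ∃ lt : V → V → Prop, IsStrictOrder V lt ∧ ∀ Y X : V, M.DependsOnE Y X → lt X Y

/-- `a` simultaneously satisfies all structural equations of `M` in context `ctx`. -/
def Solves (M : CausalModel U V RU RV) (ctx : ∀ u, RU u) (a : ∀ v, RV v) : Prop :=
  ∀ X : V, a X = M.F X ctx a

/-- `(M,ctx) ⊨ P`: `P` holds of the solution of the equations of `M` in context `ctx`. -/
def Sat (M : CausalModel U V RU RV) (ctx : ∀ u, RU u) (P : (∀ v, RV v) → Prop) : Prop :=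
  ∀ a, M.Solves ctx a → P a

/-- The intervened model `M_{S ← b}`: the equation of each variable in `S` is
replaced by the constant value given by `b`; other equations are unchanged. -/
noncomputable def intervene (M : CausalModel U V RU RV) (S : Set V) (b : ∀ v, RV v) :
    CausalModel U V RU RV where
  F X ctx a := if X ∈ S then b X else M.F X ctx a
  selfIndep := by
    intro X ctx a a' h
    by_cases hX : X ∈ S
    · simp [hX]
    · simpa [hX] using M.selfIndep X ctx a a' h

/-- `X` is a parent of `Y` (both endogenous). -/
def ParentE (M : CausalModel U V RU RV) (X Y : V) : Prop := M.DependsOnE Y X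

/-- `X` is an ancestor of `Y` (both endogenous): transitive closure of parenthood. -/
def AncestorE (M : CausalModel U V RU RV) : V → V → Prop :=
  Relation.TransGen fun X Y => M.DependsOnE Y X

/-- The exogenous variable `X` is an ancestor of the endogenous variable `Y`. -/
def AncestorX (M : CausalModel U V RU RV) (X : U) (Y : V) : Prop :=
  ∃ Z : V, M.DependsOnX Z X ∧ (Z = Y ∨ M.AncestorE Z Y)

/-- `(x,x') ⤳ (y,y')` with witness `(ctx, z)`:
`F_Y(x,z,ctx) = y` and `F_Y(x',z,ctx) = y'`. -/
def LeadsToWith (M : CausalModel U V RU RV) (X : V) (x x' : RV X) (Y : V) (y y' : RV Y)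
    (ctx : ∀ u, RU u) (z : ∀ v, RV v) : Prop :=
  M.F Y ctx (Function.update z X x) = y ∧ M.F Y ctx (Function.update z X x') = y'

/-- `x` rather than `x'` is a potential parent of `y` rather than `y'`
(single endogenous variables). -/
def PotParentEE (M : CausalModel U V RU RV) (X : V) (x x' : RV X) (Y : V) (y y' : RV Y) :
    Prop :=
  X ≠ Y ∧ x ≠ x' ∧ y ≠ y' ∧ ∃ ctx z, M.LeadsToWith X x x' Y y y' ctx z

/-- `x` rather than `x'` (values of an exogenous variable `X`) is a potential
parent of `y` rather than `y'`. -/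
def PotParentXE (M : CausalModel U V RU RV) (X : U) (x x' : RU X) (Y : V) (y y' : RV Y) :
    Prop :=
  x ≠ x' ∧ y ≠ y' ∧ ∃ (ctx : ∀ u, RU u) (z : ∀ v, RV v),
    M.F Y (Function.update ctx X x) z = y ∧ M.F Y (Function.update ctx X x') z = y'

/-- `(x,x') ⤳_p (y,y')` for some directed path `p` starting at the exogenous
variable `X`: a chain of single-variable potential-parenthood steps. -/
inductive PotAncX (M : CausalModel U V RU RV) (X : U) (x x' : RU X) :
    ∀ Y : V, RV Y → RV Y → Prop
  | base {Y : V} {y y' : RV Y} : M.PotParentXE X x x' Y y y' → PotAncX M X x x' Y y y'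
  | step {Z : V} {z z' : RV Z} {Y : V} {y y' : RV Y} :
      PotAncX M X x x' Z z z' → M.PotParentEE Z z z' Y y y' → PotAncX M X x x' Y y y'

/-- `(x,x') ⤳_p (y,y')` for some directed path `p` between endogenous variables. -/
inductive PotAncE (M : CausalModel U V RU RV) (X : V) (x x' : RV X) :
    ∀ Y : V, RV Y → RV Y → Prop
  | base {Y : V} {y y' : RV Y} : M.PotParentEE X x x' Y y y' → PotAncE M X x x' Y y y'
  | step {Z : V} {z z' : RV Z} {Y : V} {y y' : RV Y} :
      PotAncE M X x x' Z z z' → M.PotParentEE Z z z' Y y y' → PotAncE M X x x' Y y y'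

/-- Direct sufficiency, Def. 3 (with possibly mixed exogenous/endogenous source
`(Se,xe) ∪ (Sv,xv)` and target `(Te,ye) ∪ (Tv,yv)`; in the basic case
`Se = Te = ∅`).  For every context agreeing with the exogenous part of the
source and every setting `z` of the endogenous variables outside the source and
the target, the target values are guaranteed. -/
def DirectlySufficient (M : CausalModel U V RU RV)
    (Se : Set U) (xe : ∀ u, RU u) (Sv : Set V) (xv : ∀ v, RV v)
    (Te : Set U) (ye : ∀ u, RU u) (Tv : Set V) (yv : ∀ v, RV v) : Prop :=
  ∀ ctx : ∀ u, RU u, (∀ u ∈ Se, ctx u = xe u) →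
    (∀ u ∈ Te, ctx u = ye u) ∧
    ∀ z : ∀ v, RV v,
      (M.intervene (Sv ∪ (Sv ∪ Tv)ᶜ) (Sv.piecewise xv z)).Sat ctx
        fun a => ∀ v ∈ Tv, a v = yv v

/-- `(xv on Sv)` is weakly sufficient for `(yv on Tv)` w.r.t. `(M, ctx)`:
`(M,ctx) ⊨ [Sv ← xv] Tv = yv`. -/
def WeaklySufficient (M : CausalModel U V RU RV) (ctx : ∀ u, RU u)
    (Sv : Set V) (xv : ∀ v, RV v) (Tv : Set V) (yv : ∀ v, RV v) : Prop :=
  (M.intervene Sv xv).Sat ctx fun a => ∀ v ∈ Tv, a v = yv v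

/-- Sufficiency, Def. 8: the chaining (transitive closure) of direct sufficiency,
starting from a source that may contain exogenous values `(Se,xe)`. -/
inductive Sufficient (M : CausalModel U V RU RV)
    (Se : Set U) (xe : ∀ u, RU u) (Sv : Set V) (xv : ∀ v, RV v) :
    Set V → (∀ v, RV v) → Prop
  | base (Tv : Set V) (yv : ∀ v, RV v) :
      M.DirectlySufficient Se xe Sv xv ∅ xe Tv yv → Sufficient M Se xe Sv xv Tv yv
  | step (Tv : Set V) (yv : ∀ v, RV v) (Tv' : Set V) (yv' : ∀ v, RV v) :
      Sufficient M Se xe Sv xv Tv yv →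
      M.DirectlySufficient ∅ xe Tv yv ∅ xe Tv' yv' →
      Sufficient M Se xe Sv xv Tv' yv'

/-- `(x⃗,x⃗') ⤳ (y⃗,y⃗')` via the explicit witness `(Ze,ze) ∪ (Zv,zv)`:
the source and target are distinct sets of variables, the contrast values
differ on the respective domains, `(z⃗,x⃗)` is directly sufficient for `y⃗`,
`(z⃗,x⃗')` is directly sufficient for `y⃗'`, and the source is minimal. -/
def JointParentVia (M : CausalModel U V RU RV)
    (Se : Set U) (xe xe' : ∀ u, RU u) (Sv : Set V) (xv xv' : ∀ v, RV v)
    (Te : Set U) (ye ye' : ∀ u, RU u) (Tv : Set V) (yv yv' : ∀ v, RV v)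
    (Ze : Set U) (ze : ∀ u, RU u) (Zv : Set V) (zv : ∀ v, RV v) : Prop :=
  (¬(Se = Te ∧ Sv = Tv)) ∧
  (∀ u ∈ Se, xe u ≠ xe' u) ∧ (∀ v ∈ Sv, xv v ≠ xv' v) ∧
  (∀ u ∈ Te, ye u ≠ ye' u) ∧ (∀ v ∈ Tv, yv v ≠ yv' v) ∧
  Disjoint Ze Se ∧ Disjoint Zv Sv ∧
  M.DirectlySufficient (Ze ∪ Se) (Se.piecewise xe ze) (Zv ∪ Sv) (Sv.piecewise xv zv)
    Te ye Tv yv ∧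
  M.DirectlySufficient (Ze ∪ Se) (Se.piecewise xe' ze) (Zv ∪ Sv) (Sv.piecewise xv' zv)
    Te ye' Tv yv' ∧
  ∀ (Se' : Set U) (Sv' : Set V), Se' ⊆ Se → Sv' ⊆ Sv → ¬(Se' = Se ∧ Sv' = Sv) →
    ¬(M.DirectlySufficient (Ze ∪ Se') (Se'.piecewise xe ze) (Zv ∪ Sv')
        (Sv'.piecewise xv zv) Te ye Tv yv ∧
      M.DirectlySufficient (Ze ∪ Se') (Se'.piecewise xe' ze) (Zv ∪ Sv')
        (Sv'.piecewise xv' zv) Te ye' Tv yv')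

/-- Potential joint parenthood, Def. 4: `(x⃗,x⃗') ⤳ (y⃗,y⃗')` for some witness. -/
def PotJointParent (M : CausalModel U V RU RV)
    (Se : Set U) (xe xe' : ∀ u, RU u) (Sv : Set V) (xv xv' : ∀ v, RV v)
    (Te : Set U) (ye ye' : ∀ u, RU u) (Tv : Set V) (yv yv' : ∀ v, RV v) : Prop :=
  ∃ (Ze : Set U) (ze : ∀ u, RU u) (Zv : Set V) (zv : ∀ v, RV v),
    M.JointParentVia Se xe xe' Sv xv xv' Te ye ye' Tv yv yv' Ze ze Zv zv

/-- Actual joint parenthood w.r.t. `(M,u)`: potential joint parenthood by a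
witness whose exogenous part is contained in `u` and whose endogenous part
(as well as the source) takes its actual value in `(M,u)`. -/
def ActJointParent (M : CausalModel U V RU RV) (u : ∀ u, RU u)
    (Se : Set U) (xe xe' : ∀ u, RU u) (Sv : Set V) (xv xv' : ∀ v, RV v)
    (Te : Set U) (ye ye' : ∀ u, RU u) (Tv : Set V) (yv yv' : ∀ v, RV v) : Prop :=
  ∃ (Ze : Set U) (ze : ∀ u, RU u) (Zv : Set V) (zv : ∀ v, RV v),
    M.JointParentVia Se xe xe' Sv xv xv' Te ye ye' Tv yv yv' Ze ze Zv zv ∧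
    (∀ w ∈ Ze, ze w = u w) ∧ (∀ w ∈ Se, xe w = u w) ∧
    M.Sat u fun a => (∀ v ∈ Zv, a v = zv v) ∧ (∀ v ∈ Sv, a v = xv v)

/-- Potential joint ancestry, Def. 5: `(x⃗,x⃗') ⤳_n (y⃗,y⃗')` for some network `n`,
i.e. the transitive closure of potential joint parenthood. -/
inductive PotJointAnc (M : CausalModel U V RU RV)
    (Se : Set U) (xe xe' : ∀ u, RU u) (Sv : Set V) (xv xv' : ∀ v, RV v) :
    ∀ (Te : Set U) (ye ye' : ∀ u, RU u) (Tv : Set V) (yv yv' : ∀ v, RV v), Prop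
  | base {Te : Set U} {ye ye' : ∀ u, RU u} {Tv : Set V} {yv yv' : ∀ v, RV v} :
      M.PotJointParent Se xe xe' Sv xv xv' Te ye ye' Tv yv yv' →
      PotJointAnc M Se xe xe' Sv xv xv' Te ye ye' Tv yv yv'
  | step {Te : Set U} {ye ye' : ∀ u, RU u} {Tv : Set V} {yv yv' : ∀ v, RV v}
      {Te' : Set U} {ye2 ye2' : ∀ u, RU u} {Tv' : Set V} {yv2 yv2' : ∀ v, RV v} :
      PotJointAnc M Se xe xe' Sv xv xv' Te ye ye' Tv yv yv' →
      M.PotJointParent Te ye ye' Tv yv yv' Te' ye2 ye2' Tv' yv2 yv2' →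
      PotJointAnc M Se xe xe' Sv xv xv' Te' ye2 ye2' Tv' yv2 yv2'

/-- Actual joint ancestry w.r.t. `(M,u)`, Def. 7. -/
inductive ActJointAnc (M : CausalModel U V RU RV) (u : ∀ u, RU u)
    (Se : Set U) (xe xe' : ∀ u, RU u) (Sv : Set V) (xv xv' : ∀ v, RV v) :
    ∀ (Te : Set U) (ye ye' : ∀ u, RU u) (Tv : Set V) (yv yv' : ∀ v, RV v), Prop
  | base {Te : Set U} {ye ye' : ∀ u, RU u} {Tv : Set V} {yv yv' : ∀ v, RV v} :
      M.ActJointParent u Se xe xe' Sv xv xv' Te ye ye' Tv yv yv' →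
      ActJointAnc M u Se xe xe' Sv xv xv' Te ye ye' Tv yv yv'
  | step {Te : Set U} {ye ye' : ∀ u, RU u} {Tv : Set V} {yv yv' : ∀ v, RV v}
      {Te' : Set U} {ye2 ye2' : ∀ u, RU u} {Tv' : Set V} {yv2 yv2' : ∀ v, RV v} :
      ActJointAnc M u Se xe xe' Sv xv xv' Te ye ye' Tv yv yv' →
      M.ActJointParent u Te ye ye' Tv yv yv' Te' ye2 ye2' Tv' yv2 yv2' →
      ActJointAnc M u Se xe xe' Sv xv xv' Te' ye2 ye2' Tv' yv2 yv2'

/-- Combine a family of values on `A` with a family of values on `B` into a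
family of values on `A ⊕ B`. -/
def extFn {A B : Type} {RA : A → Type} {RB : B → Type}
    (f : ∀ a, RA a) (g : ∀ b, RB b) : ∀ x : A ⊕ B, Sum.elim RA RB x
  | Sum.inl a => f a
  | Sum.inr b => g b

end CausalModel

namespace CausalModel

variable {U V : Type} {RU : U → Type} {RV : V → Type}

/-- A structural equation only looks at the parents of its variable. -/
theorem F_congr_of_parents [Finite V] (M : CausalModel U V RU RV) (v : V)
    (ctx : ∀ u, RU u) (a b : ∀ v, RV v) (h : ∀ p, M.DependsOnE v p → a p = b p) :
    M.F v ctx a = M.F v ctx b := by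
  have key : ∀ s : Finset V, M.F v ctx (s.piecewise a b) = M.F v ctx b := by
    intro s
    induction s using Finset.induction_on with
    | empty => simp
    | insert p s hp ih =>
      rw [Finset.piecewise_insert, ← ih]
      by_cases hpv : p = v
      · subst hpv
        exact M.selfIndep p ctx _ _ fun q hq => Function.update_of_ne hq _ _
      · by_cases hd : M.DependsOnE v p
        · congr 1
          rw [Function.update_eq_self_iff, Finset.piecewise_eq_of_notMem _ _ _ hp]
          exact h p hd
        · by_contra hne
          refine hd ⟨hpv, ctx, s.piecewise a b, a p, s.piecewise a b p, ?_⟩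
          rwa [Function.update_eq_self]
  have := Fintype.ofFinite V
  simpa using key Finset.univ

theorem DependsOnE.of_intervene {M : CausalModel U V RU RV} {S : Set V} {b : ∀ v, RV v}
    {Y X : V} (h : (M.intervene S b).DependsOnE Y X) : M.DependsOnE Y X := by
  obtain ⟨hne, ctx, a, x, x', hF⟩ := h
  refine ⟨hne, ctx, a, x, x', fun heq => hF ?_⟩
  simp only [intervene, heq]

theorem StronglyRecursive.intervene {M : CausalModel U V RU RV} (hM : M.StronglyRecursive)
    (S : Set V) (b : ∀ v, RV v) : (M.intervene S b).StronglyRecursive := by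
  obtain ⟨lt, hlt, hdep⟩ := hM
  exact ⟨lt, hlt, fun Y X h => hdep Y X h.of_intervene⟩

theorem StronglyRecursive.wellFounded_parent [Finite V] {M : CausalModel U V RU RV}
    (hM : M.StronglyRecursive) : WellFounded fun X Y => M.DependsOnE Y X := by
  obtain ⟨lt, hlt, hdep⟩ := hM
  exact Subrelation.wf (fun {X Y} h => hdep Y X h) (Finite.wellFounded_of_trans_of_irrefl lt)

/-- A strongly recursive model with finitely many endogenous variables has a solution
in every context. -/
theorem StronglyRecursive.exists_solves [Finite V] {M : CausalModel U V RU RV}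
    (hM : M.StronglyRecursive) (hRV : ∀ v, Nonempty (RV v)) (ctx : ∀ u, RU u) :
    ∃ a, M.Solves ctx a := by
  have wf := hM.wellFounded_parent
  let step : ∀ v, (∀ p, M.DependsOnE v p → RV p) → RV v := fun v g =>
    M.F v ctx fun p => if h : M.DependsOnE v p then g p h else (hRV p).some
  refine ⟨wf.fix step, fun v => ?_⟩
  rw [wf.fix_eq]
  refine M.F_congr_of_parents v ctx _ _ fun p hp => ?_
  simp [hp]

theorem Solves.eq_of_mem {M : CausalModel U V RU RV} {S : Set V} {b a : ∀ v, RV v}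
    {ctx : ∀ u, RU u} (h : (M.intervene S b).Solves ctx a) {v : V} (hv : v ∈ S) :
    a v = b v := by
  simpa [intervene, hv] using h v

theorem Solves.eq_of_notMem {M : CausalModel U V RU RV} {S : Set V} {b a : ∀ v, RV v}
    {ctx : ∀ u, RU u} (h : (M.intervene S b).Solves ctx a) {v : V} (hv : v ∉ S) :
    a v = M.F v ctx a := by
  simpa [intervene, hv] using h v

/-- The part of direct sufficiency of `(T,t)` for `(T',t')` that concerns a single context. -/
def DirectlySufficientIn (M : CausalModel U V RU RV) (ctx : ∀ u, RU u)
    (T : Set V) (t : ∀ v, RV v) (T' : Set V) (t' : ∀ v, RV v) : Prop :=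
  ∀ z : ∀ v, RV v, (M.intervene (T ∪ (T ∪ T')ᶜ) (T.piecewise t z)).Sat ctx
    fun a => ∀ v ∈ T', a v = t' v

theorem DirectlySufficientIn.eq_of_mem [Finite V] {M : CausalModel U V RU RV}
    (hM : M.StronglyRecursive) (hRV : ∀ v, Nonempty (RV v)) {ctx : ∀ u, RU u}
    {T T' : Set V} {t t' : ∀ v, RV v} (h : M.DirectlySufficientIn ctx T t T' t')
    {v : V} (hv : v ∈ T) (hv' : v ∈ T') : t' v = t v := by
  obtain ⟨b, hb⟩ := (hM.intervene (T ∪ (T ∪ T')ᶜ) (T.piecewise t t)).exists_solves hRV ctx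
  rw [← h t b hb v hv', hb.eq_of_mem (Or.inl hv), Set.piecewise_eq_of_mem _ _ _ hv]

/-- If the source and target agree with `a` on the parents of a newly derived variable,
then that variable gets the value its structural equation assigns under `a`. -/
theorem DirectlySufficientIn.eq_F [Finite V] {M : CausalModel U V RU RV}
    (hM : M.StronglyRecursive) (hRV : ∀ v, Nonempty (RV v)) {ctx : ∀ u, RU u}
    {T T' : Set V} {t t' : ∀ v, RV v} (h : M.DirectlySufficientIn ctx T t T' t')
    {a : ∀ v, RV v} {v : V} (hv : v ∉ T) (hv' : v ∈ T')
    (hp : ∀ p, M.DependsOnE v p → (p ∈ T → t p = a p) ∧ (p ∈ T' → t' p = a p)) :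
    t' v = M.F v ctx a := by
  obtain ⟨b, hb⟩ := (hM.intervene (T ∪ (T ∪ T')ᶜ) (T.piecewise t a)).exists_solves hRV ctx
  have hvn : v ∉ T ∪ (T ∪ T')ᶜ := by simp [hv, hv']
  rw [← h a b hb v hv', hb.eq_of_notMem hvn]
  refine M.F_congr_of_parents v ctx _ _ fun p hd => ?_
  by_cases hpT : p ∈ T
  · rw [hb.eq_of_mem (Or.inl hpT), Set.piecewise_eq_of_mem _ _ _ hpT, (hp p hd).1 hpT]
  by_cases hpT' : p ∈ T'
  · rw [h a b hb p hpT', (hp p hd).2 hpT']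
  · rw [hb.eq_of_mem (Or.inr (by simp [hpT, hpT'])), Set.piecewise_eq_of_notMem _ _ _ hpT]

/-- Consistency of the values `(T,t)` with `a`: at any variable `v`, `t` agrees with `a`
provided that `T` still carries the `a`-values of all the variables at or above `v`
in the causal graph whose equations `a` violates. -/
def ConsistentWith (M : CausalModel U V RU RV) (ctx : ∀ u, RU u) (a : ∀ v, RV v)
    (T : Set V) (t : ∀ v, RV v) : Prop :=
  ∀ v, (∀ u, Relation.ReflTransGen (fun X Y => M.DependsOnE Y X) u v →
      a u ≠ M.F u ctx a → u ∈ T ∧ t u = a u) → v ∈ T → t v = a v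

theorem ConsistentWith.step [Finite V] {M : CausalModel U V RU RV}
    (hM : M.StronglyRecursive) (hRV : ∀ v, Nonempty (RV v)) {ctx : ∀ u, RU u}
    {a : ∀ v, RV v} {T T' : Set V} {t t' : ∀ v, RV v} (hT : M.ConsistentWith ctx a T t)
    (h : M.DirectlySufficientIn ctx T t T' t') : M.ConsistentWith ctx a T' t' := by
  have key : ∀ v, (∀ u, Relation.ReflTransGen (fun X Y => M.DependsOnE Y X) u v →
      a u ≠ M.F u ctx a → u ∈ T' ∧ t' u = a u) →
      (∀ u, Relation.ReflTransGen (fun X Y => M.DependsOnE Y X) u v →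
        a u ≠ M.F u ctx a → u ∈ T ∧ t u = a u) ∧ (v ∈ T → t v = a v) ∧
      (v ∈ T' → t' v = a v) := by
    intro v
    induction v using hM.wellFounded_parent.induction with
    | _ v ih =>
      intro hv
      have hpar : ∀ p, M.DependsOnE v p → _ := fun p hp =>
        ih p hp fun u hu => hv u (hu.tail hp)
      have hnew : v ∉ T → v ∈ T' → t' v = M.F v ctx a := fun h1 h2 =>
        h.eq_F hM hRV h1 h2 fun p hp => (hpar p hp).2
      have hold : ∀ u, Relation.ReflTransGen (fun X Y => M.DependsOnE Y X) u v →
          a u ≠ M.F u ctx a → u ∈ T ∧ t u = a u := by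
        intro u hu hne
        rcases hu.cases_tail with rfl | ⟨p, hup, hp⟩
        · obtain ⟨hm, he⟩ := hv v .refl hne
          by_cases hvT : v ∈ T
          · exact ⟨hvT, by rw [← h.eq_of_mem hM hRV hvT hm, he]⟩
          · exact absurd (he.symm.trans (hnew hvT hm)) hne
        · exact (hpar p hp).1 u hup hne
      have hvT := hT v hold
      refine ⟨hold, hvT, fun hm => ?_⟩
      by_cases hmT : v ∈ T
      · rw [h.eq_of_mem hM hRV hmT hm, hvT hmT]
      · by_cases hne : a v = M.F v ctx a
        · rw [hnew hmT hm, ← hne]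
        · exact (hv v .refl hne).2
  exact fun v hv => (key v hv).2.2

theorem Sufficient.consistentWith [Finite V] {M : CausalModel U V RU RV}
    (hM : M.StronglyRecursive) (hRV : ∀ v, Nonempty (RV v)) {ctx : ∀ u, RU u}
    {a : ∀ v, RV v} {Se : Set U} {xe : ∀ u, RU u} {Sv : Set V} {xv : ∀ v, RV v}
    (hctx : ∀ u ∈ Se, ctx u = xe u) (hxv : ∀ v ∈ Sv, xv v = a v)
    {Tv : Set V} {yv : ∀ v, RV v} (h : M.Sufficient Se xe Sv xv Tv yv) :
    M.ConsistentWith ctx a Tv yv := by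
  induction h with
  | base T t hd =>
    exact ConsistentWith.step hM hRV (fun v _ hv => hxv v hv) (hd ctx hctx).2
  | step T t T' t' _ hd ih =>
    exact ih.step hM hRV (hd ctx (by simp)).2

/-- If `(xv on Sv)` is sufficient for values that preserve `xv` on `Sv`, then those values
hold in every solution after intervening on `Sv`. -/
theorem Sufficient.eq_of_solves [Finite V] {M : CausalModel U V RU RV}
    (hM : M.StronglyRecursive) (hRV : ∀ v, Nonempty (RV v)) {ctx : ∀ u, RU u}
    {Se : Set U} {xe : ∀ u, RU u} {Sv : Set V} {xv : ∀ v, RV v}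
    (hctx : ∀ u ∈ Se, ctx u = xe u) {Tv : Set V} {yv : ∀ v, RV v}
    (h : M.Sufficient Se xe Sv xv Tv yv) (hST : ∀ v ∈ Sv, v ∈ Tv ∧ yv v = xv v)
    {a : ∀ v, RV v} (ha : (M.intervene Sv xv).Solves ctx a) {v : V} (hv : v ∈ Tv) :
    yv v = a v := by
  refine h.consistentWith hM hRV hctx (fun u hu => (ha.eq_of_mem hu).symm) v
    (fun u _ hne => ?_) hv
  have hu : u ∈ Sv := by_contra fun hu => hne (ha.eq_of_notMem hu)
  exact ⟨(hST u hu).1, by rw [(hST u hu).2, ha.eq_of_mem hu]⟩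

/-- Interventions that differ only at non-ancestors of `Y` give `Y` the same value. -/
theorem Solves.eq_of_agree_on_ancestors [Finite V] {M : CausalModel U V RU RV}
    (hM : M.StronglyRecursive) {ctx : ∀ u, RU u} {S : Set V} {b b' a a' : ∀ v, RV v} {Y : V}
    (hbb' : ∀ v ∈ S, Relation.ReflTransGen (fun X Y => M.DependsOnE Y X) v Y → b v = b' v)
    (ha : (M.intervene S b).Solves ctx a) (ha' : (M.intervene S b').Solves ctx a') :
    a Y = a' Y := by
  have key : ∀ v, Relation.ReflTransGen (fun X Y => M.DependsOnE Y X) v Y → a v = a' v := by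
    intro v
    induction v using hM.wellFounded_parent.induction with
    | _ v ih =>
      intro hv
      by_cases hS : v ∈ S
      · rw [ha.eq_of_mem hS, ha'.eq_of_mem hS, hbb' v hS hv]
      · rw [ha.eq_of_notMem hS, ha'.eq_of_notMem hS]
        exact M.F_congr_of_parents v ctx _ _ fun p hp => ih p hp (hv.head hp)
  exact key Y .refl

/-- All exogenous values together with values for all the other endogenous variables
are sufficient for those values and the value determined by the equation of `Y`. -/
theorem sufficient_update_F (M : CausalModel U V RU RV) (ctx : ∀ u, RU u)
    (a : ∀ v, RV v) (Y : V) :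
    M.Sufficient Set.univ ctx {Y}ᶜ a Set.univ (Function.update a Y (M.F Y ctx a)) := by
  refine .base _ _ fun c hc => ⟨by simp, fun z b hb => ?_⟩
  obtain rfl : c = ctx := funext fun u => hc u trivial
  have hoff : ∀ v, v ≠ Y → b v = a v := fun v hv => by
    rw [hb.eq_of_mem (Or.inl hv), Set.piecewise, if_pos (by simpa using hv)]
  rintro v -
  by_cases hv : v = Y
  · subst hv
    rw [Function.update_self, hb.eq_of_notMem (by simp)]
    exact M.selfIndep v c _ _ hoff
  · rw [Function.update_of_ne hv, hoff v hv]

end CausalModel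

open CausalModel in
/-- Corollary of Theorems 1 and 2: Let `M = ((U,V,R),F)` and
`M' = ((U ⊕ W, V ⊕ V₂, R'), F')` be strongly recursive causal models (so the
exogenous resp. endogenous variables of `M` are contained in those of `M'`,
with `W = U' − U`).  If `M` is functionally equivalent to `M'` with some
witness `wv` for the marginalized exogenous variables `W`, then for all common
endogenous variables `X, Y ∈ V`: if `X` is an ancestor of `Y` in `M` then `X`
is an ancestor of `Y` in `M'`. -/
theorem functionallyEquivalent_preserves_ancestors
    {U W V V₂ : Type} [Finite U] [Finite W] [Finite V] [Finite V₂]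
    {RU : U → Type} {RW : W → Type} {RV : V → Type} {RV₂ : V₂ → Type}
    (hRU : ∀ u, Nonempty (RU u)) (hRW : ∀ w, Nonempty (RW w))
    (hRV : ∀ v, Nonempty (RV v)) (hRV₂ : ∀ v, Nonempty (RV₂ v))
    (M : CausalModel U V RU RV)
    (M' : CausalModel (U ⊕ W) (V ⊕ V₂) (Sum.elim RU RW) (Sum.elim RV RV₂))
    (hM : M.StronglyRecursive) (hM' : M'.StronglyRecursive)
    (wv : ∀ w, RW w) (d₂ : ∀ v, RV₂ v)
    (hfun : ∀ (Se : Set U) (xe : ∀ u, RU u) (Sv : Set V) (xv : ∀ v, RV v)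
        (Tv : Set V) (yv : ∀ v, RV v),
        M.Sufficient Se xe Sv xv Tv yv ↔
        M'.Sufficient (Sum.inl '' Se ∪ Sum.inr '' (Set.univ : Set W)) (extFn xe wv)
          (Sum.inl '' Sv) (extFn xv d₂) (Sum.inl '' Tv) (extFn yv d₂)) :
    ∀ X Y : V, M.AncestorE X Y → M'.AncestorE (Sum.inl X) (Sum.inl Y) := by
  have hR : ∀ v, Nonempty (Sum.elim RV RV₂ v) := by
    rintro (v | v)
    exacts [hRV v, hRV₂ v]
  have value_eq : ∀ (ctx : ∀ u, RU u) (a : ∀ v, RV v) (Y : V)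
      (b : ∀ v, Sum.elim RV RV₂ v),
      (M'.intervene (Sum.inl '' {Y}ᶜ) (extFn a d₂)).Solves (extFn ctx wv) b →
      M.F Y ctx a = b (Sum.inl Y) := by
    intro ctx a Y b hb
    have hs := (hfun _ _ _ _ _ _).1 (M.sufficient_update_F ctx a Y)
    have := hs.eq_of_solves hM' hR (fun _ _ => rfl) ?_ hb
      (Set.mem_image_of_mem Sum.inl (Set.mem_univ Y))
    · simpa [extFn] using this
    · rintro _ ⟨v, hv, rfl⟩
      exact ⟨Set.mem_image_of_mem _ trivial, Function.update_of_ne hv _ _⟩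
  have parent : ∀ X Y : V, M.DependsOnE Y X → M'.AncestorE (Sum.inl X) (Sum.inl Y) := by
    rintro X Y ⟨hne, ctx, a, x, x', hF⟩
    by_contra hanc
    have hsol := fun c => (hM'.intervene (Sum.inl '' {Y}ᶜ)
      (extFn (Function.update a X c) d₂)).exists_solves hR (extFn ctx wv)
    obtain ⟨b, hb⟩ := hsol x
    obtain ⟨b', hb'⟩ := hsol x'
    refine hF ?_
    rw [value_eq _ _ _ _ hb, value_eq _ _ _ _ hb']
    refine CausalModel.Solves.eq_of_agree_on_ancestors hM' ?_ hb hb'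
    rintro _ ⟨v, hv, rfl⟩ hvY
    have hvX : v ≠ X := by
      rintro rfl
      rcases Relation.reflTransGen_iff_eq_or_transGen.1 hvY with h | h
      · exact hne (Sum.inl_injective h).symm
      · exact hanc h
    simp [extFn, hvX]
  intro X Y h
  induction h with
  | single h => exact parent _ _ h
  | tail _ h ih => exact ih.trans (parent _ _ h)
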